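/- Let q be a prime power. There exist real constants A > 0 and ε > 0 such that for every function k : ℕ → ℕ satisfying k(n) ≤ n for all n and lim_{n→∞} ( n²/4 − ε·n + A·√n − k(n)·(n − k(n)) ) = −∞ (condition (⋆)), the number N^M_{k(n),n} of monomial equivalence classes of k(n)-dimensional linear codes in F_q^n satisfies N^M_{k(n),n} ∼ q^{k(n)·(n − k(n))} / ( K_q · n! · (q−1)^{n−1} ) as n → ∞. -/

import Mathlib

open Filter Matrix
open scoped Topology

/-- The `q`-binomial coefficient `binom(n,k)_q = ∏_{j=0}^{k-1} (q^{n-j}-1)/(q^{k-j}-1)`. -/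
noncomputable def qBinom (q n k : ℕ) : ℝ :=
  ∏ j ∈ Finset.range k, ((q : ℝ) ^ (n - j) - 1) / ((q : ℝ) ^ (k - j) - 1)

/-- `S(n) = ∑_{k=0}^n binom(n,k)_q`. -/
noncomputable def Sq (q n : ℕ) : ℝ := ∑ k ∈ Finset.range (n + 1), qBinom q n k

/-- `K_q = ∏_{j=1}^∞ (1 - q^{-j})`. -/
noncomputable def Kq (q : ℕ) : ℝ := ∏' j : ℕ, (1 - ((q : ℝ))⁻¹ ^ (j + 1))

/-- `K_q(k) = ∏_{j=1}^{k} (1 - q^{-j})`. -/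
noncomputable def KqTrunc (q k : ℕ) : ℝ := ∏ j ∈ Finset.range k, (1 - ((q : ℝ))⁻¹ ^ (j + 1))

/-- Jacobi theta constant `θ₂(w) = ∑_{k∈ℤ} w^{(k+1/2)²}`. -/
noncomputable def theta2 (w : ℝ) : ℝ := ∑' k : ℤ, w ^ (((k : ℝ) + 1/2) ^ 2)

/-- Jacobi theta constant `θ₃(w) = ∑_{k∈ℤ} w^{k²}`. -/
noncomputable def theta3 (w : ℝ) : ℝ := ∑' k : ℤ, w ^ ((k : ℝ) ^ 2)

/-- Condition (⋆): `n²/4 − ε·n + A·√n − k(n)(n−k(n)) → −∞`. -/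
def StarCond (A ε : ℝ) (k : ℕ → ℕ) : Prop :=
  Tendsto (fun n : ℕ =>
    (n : ℝ) ^ 2 / 4 - ε * n + A * Real.sqrt n - (k n : ℝ) * ((n : ℝ) - (k n : ℝ)))
    atTop atBot

/-- The set of permutation matrices inside `GL n F`. -/
def permSet (F : Type) [Field F] (n : ℕ) : Set (GL (Fin n) F) :=
  {M | ∃ σ : Equiv.Perm (Fin n), (M : Matrix (Fin n) (Fin n) F) = σ.permMatrix F}

/-- The set of invertible diagonal matrices inside `GL n F`. -/
def diagSet (F : Type) [Field F] (n : ℕ) : Set (GL (Fin n) F) :=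
  {M | ∃ d : Fin n → F, (M : Matrix (Fin n) (Fin n) F) = Matrix.diagonal d}

/-- The permutation group: subgroup of `GL n F` formed by the permutation matrices. -/
def PermGroup (F : Type) [Field F] (n : ℕ) : Subgroup (GL (Fin n) F) :=
  Subgroup.closure (permSet F n)

/-- The monomial group: subgroup of `GL n F` generated by permutation and diagonal matrices. -/
def MonomialGroup (F : Type) [Field F] (n : ℕ) : Subgroup (GL (Fin n) F) :=
  Subgroup.closure (permSet F n ∪ diagSet F n)

/-- Number of orbits of a subgroup `G ≤ GL n F` acting on the Grassmannian of
`k`-dimensional subspaces of `F^n` (by taking images of subspaces). -/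
noncomputable def numClassesDim {n : ℕ} (F : Type) [Field F]
    (G : Subgroup (GL (Fin n) F)) (k : ℕ) : ℕ :=
  Nat.card (Quot (fun V W : {V : Submodule F (Fin n → F) // Module.finrank F V = k} =>
    ∃ M ∈ G, Submodule.map (Matrix.toLin' (M : Matrix (Fin n) (Fin n) F)) V.1 = W.1))

/-- Number of orbits of a subgroup `G ≤ GL n F` acting on the set of all subspaces of `F^n`. -/
noncomputable def numClasses {n : ℕ} (F : Type) [Field F]
    (G : Subgroup (GL (Fin n) F)) : ℕ :=
  Nat.card (Quot (fun V W : Submodule F (Fin n → F) =>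
    ∃ M ∈ G, Submodule.map (Matrix.toLin' (M : Matrix (Fin n) (Fin n) F)) V = W))

/-- Semilinear orbit relation: `W` is the image of `V` under the semilinear transformation
given by applying the field automorphism `σ` componentwise followed by a monomial matrix. -/
def semiRel (F : Type) [Field F] (n : ℕ) (V W : Submodule F (Fin n → F)) : Prop :=
  ∃ σ : F ≃+* F, ∃ M ∈ MonomialGroup F n,
    (W : Set (Fin n → F)) =
      (fun x => Matrix.mulVec (M : Matrix (Fin n) (Fin n) F) (fun i => σ (x i))) '' (V : Set (Fin n → F))

/-- Number of semilinear equivalence classes of `k`-dimensional subspaces of `F^n`. -/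
noncomputable def numClassesDimSemi (F : Type) [Field F] (n k : ℕ) : ℕ :=
  Nat.card (Quot (fun V W : {V : Submodule F (Fin n → F) // Module.finrank F V = k} =>
    semiRel F n V.1 W.1))

/-- Number of semilinear equivalence classes of subspaces of `F^n`. -/
noncomputable def numClassesSemi (F : Type) [Field F] (n : ℕ) : ℕ :=
  Nat.card (Quot (fun V W : Submodule F (Fin n → F) => semiRel F n V W))

section KqFacts

lemma KqTrunc_pos {q : ℕ} (hq : 2 ≤ q) (k : ℕ) : 0 < KqTrunc q k := by
  refine Finset.prod_pos fun j _ => ?_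
  have h1 : ((q : ℝ))⁻¹ < 1 := inv_lt_one_of_one_lt₀ (by exact_mod_cast hq)
  have h2 : ((q : ℝ))⁻¹ ^ (j + 1) < 1 := pow_lt_one₀ (by positivity) h1 (by omega)
  linarith

lemma KqTrunc_antitone {q : ℕ} (hq : 2 ≤ q) : Antitone (KqTrunc q) := by
  refine antitone_nat_of_succ_le fun n => ?_
  have h := KqTrunc_pos hq n
  rw [KqTrunc, Finset.prod_range_succ]
  refine mul_le_of_le_one_right h.le ?_
  have : (0 : ℝ) ≤ ((q : ℝ))⁻¹ ^ (n + 1) := by positivity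
  linarith

lemma summable_inv_pow_succ {q : ℕ} (hq : 2 ≤ q) :
    Summable fun j : ℕ => ((q : ℝ))⁻¹ ^ (j + 1) := by
  have h1 : ((q : ℝ))⁻¹ < 1 := inv_lt_one_of_one_lt₀ (by exact_mod_cast hq)
  exact (summable_nat_add_iff 1).2 (summable_geometric_of_lt_one (by positivity) h1)

lemma tendsto_KqTrunc {q : ℕ} (hq : 2 ≤ q) :
    Tendsto (KqTrunc q) atTop (𝓝 (Kq q)) := by
  have h : Multipliable fun j : ℕ => (1 - ((q : ℝ))⁻¹ ^ (j + 1)) := by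
    simpa [sub_eq_add_neg] using
      Real.multipliable_one_add_of_summable (summable_inv_pow_succ hq).neg
  exact h.hasProd.tendsto_prod_nat

lemma Kq_le_KqTrunc {q : ℕ} (hq : 2 ≤ q) (k : ℕ) : Kq q ≤ KqTrunc q k :=
  (KqTrunc_antitone hq).le_of_tendsto (tendsto_KqTrunc hq) k

lemma Kq_pos {q : ℕ} (hq : 2 ≤ q) : 0 < Kq q := by
  have h0 : 0 ≤ Kq q :=
    ge_of_tendsto' (tendsto_KqTrunc hq) fun k => (KqTrunc_pos hq k).le
  refine lt_of_le_of_ne h0 (Ne.symm ?_)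
  have h1 : ((q : ℝ))⁻¹ < 1 := inv_lt_one_of_one_lt₀ (by exact_mod_cast hq)
  have := tprod_one_add_ne_zero_of_summable (R := ℝ)
    (f := fun j : ℕ => -((q : ℝ))⁻¹ ^ (j + 1)) (fun j => ?_) ?_
  · simpa [Kq, sub_eq_add_neg] using this
  · have h2 : ((q : ℝ))⁻¹ ^ (j + 1) < 1 := pow_lt_one₀ (by positivity) h1 (by omega)
    have : 0 < 1 + -((q : ℝ))⁻¹ ^ (j + 1) := by linarith
    exact this.ne'
  · simpa using summable_inv_pow_succ hq

lemma Kq_le_one {q : ℕ} (hq : 2 ≤ q) : Kq q ≤ 1 := by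
  simpa [KqTrunc] using Kq_le_KqTrunc hq 0

end KqFacts

section Grassmannian

variable {F V : Type*} [Field F] [Fintype F] [AddCommGroup V] [Module F V]

open Module

omit [Fintype F] in
lemma span_range_coe_eq [Finite V] {k : ℕ} {W : Submodule F V} (hW : finrank F W = k)
    {s : Fin k → W} (hs : LinearIndependent F s) :
    Submodule.span F (Set.range fun i => (s i : V)) = W := by
  apply Submodule.eq_of_le_of_finrank_eq
  · rw [Submodule.span_le]
    rintro _ ⟨i, rfl⟩
    exact (s i).2
  · rw [hW]
    exact (finrank_span_eq_card (hs.map' W.subtype (Submodule.ker_subtype _))).trans (by simp)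

/-- The span of a linearly independent tuple, as a point of the Grassmannian. -/
def spanOfLinearIndependent (F V : Type*) [Field F] [AddCommGroup V] [Module F V] (k : ℕ)
    (s : {s : Fin k → V // LinearIndependent F s}) : {W : Submodule F V // finrank F W = k} :=
  ⟨Submodule.span F (Set.range s.1), by simpa using finrank_span_eq_card s.2⟩

/-- Linearly independent `k`-tuples spanning a given `k`-dimensional subspace `W` are the same as
linearly independent `k`-tuples in `W`. -/
def spanFiberEquiv [Finite V] {k : ℕ} (W : {W : Submodule F V // finrank F W = k}) :
    {s // spanOfLinearIndependent F V k s = W} ≃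
      {s : Fin k → W.1 // LinearIndependent F s} where
  toFun s := ⟨fun i => ⟨s.1.1 i, by
      have h : Submodule.span F (Set.range s.1.1) = W.1 := congrArg Subtype.val s.2
      rw [← h]
      exact Submodule.subset_span ⟨i, rfl⟩⟩,
    LinearIndependent.of_comp W.1.subtype s.1.2⟩
  invFun s := ⟨⟨fun i => (s.1 i : V), s.2.map' W.1.subtype (Submodule.ker_subtype _)⟩,
    Subtype.ext (span_range_coe_eq W.2 s.2)⟩
  left_inv _ := rfl
  right_inv _ := rfl

lemma card_grassmannian_mul [Finite V] {k : ℕ} (hk : k ≤ finrank F V) :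
    Nat.card {W : Submodule F V // finrank F W = k} *
      ∏ i : Fin k, (Fintype.card F ^ k - Fintype.card F ^ i.val) =
    ∏ i : Fin k, (Fintype.card F ^ finrank F V - Fintype.card F ^ i.val) := by
  have : Fintype {W : Submodule F V // finrank F W = k} := Fintype.ofFinite _
  rw [← card_linearIndependent (K := F) (V := V) hk,
    Nat.card_congr (Equiv.sigmaFiberEquiv (spanOfLinearIndependent F V k)).symm, Nat.card_sigma]
  rw [Finset.sum_congr rfl
    (g := fun _ => ∏ i : Fin k, (Fintype.card F ^ k - Fintype.card F ^ i.val))]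
  · simp [Nat.card_eq_fintype_card]
  · intro W _
    rw [Nat.card_congr (spanFiberEquiv W), card_linearIndependent (K := F) (V := W.1) W.2.ge, W.2]

lemma prod_pow_sub_pow {q : ℕ} (hq : 2 ≤ q) {k n : ℕ} (hk : k ≤ n) :
    ((∏ i : Fin k, (q ^ n - q ^ i.val) : ℕ) : ℝ) * KqTrunc q (n - k) =
      (q : ℝ) ^ (n * k) * KqTrunc q n := by
  rw [Fin.prod_univ_eq_prod_range (fun i => q ^ n - q ^ i) k]
  induction k with
  | zero => simp
  | succ k ih =>
    have h1 := ih (by omega)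
    obtain ⟨m, rfl⟩ : ∃ m, n = m + 1 + k := ⟨n - (k + 1), by omega⟩
    have e1 : m + 1 + k - k = m + 1 := by omega
    have e2 : m + 1 + k - (k + 1) = m := by omega
    rw [e1] at h1
    have e3 : (q : ℝ) ^ ((m + 1 + k) * (k + 1)) * KqTrunc q (m + 1 + k) =
        (q : ℝ) ^ (m + 1 + k) * ((q : ℝ) ^ ((m + 1 + k) * k) * KqTrunc q (m + 1 + k)) := by
      ring
    rw [e2, e3, ← h1, Finset.prod_range_succ, Nat.cast_mul,
      Nat.cast_sub (Nat.pow_le_pow_right (by omega) (by omega))]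
    have : KqTrunc q (m + 1) = KqTrunc q m * (1 - ((q : ℝ))⁻¹ ^ (m + 1)) := by
      simp [KqTrunc, Finset.prod_range_succ]
    rw [this]
    have hq0 : (q : ℝ) ≠ 0 := by positivity
    have h3 : ((q : ℝ) ^ (m + 1 + k)) * (1 - ((q : ℝ))⁻¹ ^ (m + 1)) =
        (q : ℝ) ^ (m + 1 + k) - (q : ℝ) ^ k := by
      rw [mul_sub, mul_one, pow_add, inv_pow]
      field_simp
    rw [Nat.cast_pow, Nat.cast_pow, ← h3]
    ring

/-- The cardinality of a Grassmannian over a finite field. -/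
lemma card_grassmannian [Finite V] {k : ℕ} (hk : k ≤ finrank F V) :
    (Nat.card {W : Submodule F V // finrank F W = k} : ℝ) =
      (Fintype.card F : ℝ) ^ (k * (finrank F V - k)) *
        (KqTrunc (Fintype.card F) (finrank F V) /
          (KqTrunc (Fintype.card F) (finrank F V - k) * KqTrunc (Fintype.card F) k)) := by
  have hq : 2 ≤ Fintype.card F := Fintype.one_lt_card
  have h := congrArg (Nat.cast (R := ℝ)) (card_grassmannian_mul (F := F) (V := V) hk)
  have h1 := prod_pow_sub_pow hq hk
  have h2 := prod_pow_sub_pow hq (le_refl k)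
  rw [Nat.cast_mul] at h
  rw [Nat.sub_self] at h2
  have p1 := KqTrunc_pos hq (finrank F V - k)
  have p2 := KqTrunc_pos hq k
  have h0 : KqTrunc (Fintype.card F) 0 = 1 := by simp [KqTrunc]
  rw [h0, mul_one] at h2
  rw [h2] at h
  rw [← h] at h1
  generalize finrank F V = n at *
  obtain ⟨m, rfl⟩ := Nat.exists_eq_add_of_le hk
  rw [Nat.add_sub_cancel_left] at *
  have hq0 : (0 : ℝ) < Fintype.card F := by positivity
  rw [mul_div_assoc', eq_div_iff (by positivity)]
  have hp : (0 : ℝ) < (Fintype.card F : ℝ) ^ (k * k) := by positivity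
  apply mul_left_cancel₀ hp.ne'
  calc _ = _ := by ring
    _ = _ := h1
    _ = _ := by ring

lemma card_grassmannian_le [Finite V] (k : ℕ) :
    (Nat.card {W : Submodule F V // finrank F W = k} : ℝ) ≤
      (Kq (Fintype.card F))⁻¹ * (Fintype.card F : ℝ) ^ (k * (finrank F V - k)) := by
  have hq : 2 ≤ Fintype.card F := Fintype.one_lt_card
  have hK := Kq_pos hq
  by_cases hk : k ≤ finrank F V
  · rw [card_grassmannian hk, mul_comm]
    gcongr
    have p1 := KqTrunc_pos hq (finrank F V - k)
    have p2 := KqTrunc_pos hq k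
    have h1 : KqTrunc (Fintype.card F) (finrank F V) ≤ KqTrunc (Fintype.card F) (finrank F V - k) :=
      KqTrunc_antitone hq (Nat.sub_le _ _)
    rw [div_le_iff₀ (by positivity)]
    have h2 : 1 ≤ (Kq (Fintype.card F))⁻¹ * KqTrunc (Fintype.card F) k := by
      rw [inv_mul_eq_div, one_le_div hK]
      exact Kq_le_KqTrunc hq k
    nlinarith
  · have : IsEmpty {W : Submodule F V // finrank F W = k} :=
      ⟨fun W => hk (W.2 ▸ Submodule.finrank_le _)⟩
    rw [Nat.card_of_isEmpty]
    simp only [Nat.cast_zero]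
    positivity

end Grassmannian

section Counting

variable {F V : Type*} [Field F] [AddCommGroup V] [Module F V]

open Module

lemma finrank_map_add_finrank_inf_ker [FiniteDimensional F V] {V' : Type*} [AddCommGroup V']
    [Module F V'] (f : V →ₗ[F] V') (W : Submodule F V) :
    finrank F (W.map f) + finrank F (W ⊓ LinearMap.ker f : Submodule F V) = finrank F W := by
  have h := LinearMap.finrank_range_add_finrank_ker (f.domRestrict W)
  rw [LinearMap.range_domRestrict, LinearMap.ker_domRestrict] at h
  rw [← h, ← Submodule.map_comap_subtype, Submodule.finrank_map_subtype_eq]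

variable [Fintype F] [Finite V]

lemma ncard_superspaces_le {U : Submodule F V} {e : ℕ} (hU : finrank F U = e) (k : ℕ) :
    (({W : Submodule F V | U ≤ W ∧ finrank F W = k} : Set _).ncard : ℝ) ≤
      (Kq (Fintype.card F))⁻¹ * (Fintype.card F : ℝ) ^ ((k - e) * (finrank F V - k)) := by
  have hfd : FiniteDimensional F V := inferInstance
  have hq : 2 ≤ Fintype.card F := Fintype.one_lt_card
  have hK := Kq_pos hq
  rcases ({W : Submodule F V | U ≤ W ∧ finrank F W = k} : Set _).eq_empty_or_nonempty with h | h
  · rw [h, Set.ncard_empty, Nat.cast_zero]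
    positivity
  · obtain ⟨W₀, hUW, hW₀⟩ := h
    have hek : e ≤ k := hU ▸ hW₀ ▸ Submodule.finrank_mono hUW
    have hquot := Submodule.finrank_quotient_add_finrank U
    have hfin : Finite (V ⧸ U) := Finite.of_surjective U.mkQ U.mkQ_surjective
    have h2 := card_grassmannian_le (F := F) (V := V ⧸ U) (k - e)
    have e1 : finrank F (V ⧸ U) - (k - e) = finrank F V - k := by omega
    rw [e1] at h2
    refine le_trans ?_ h2
    norm_cast
    let φ : {W : Submodule F V | U ≤ W ∧ finrank F W = k} →
        {W : Submodule F (V ⧸ U) // finrank F W = k - e} := fun W => ⟨W.1.map U.mkQ, by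
      have h3 := finrank_map_add_finrank_inf_ker U.mkQ W.1
      rw [Submodule.ker_mkQ, inf_eq_right.2 W.2.1, hU, W.2.2] at h3
      omega⟩
    refine Nat.card_le_card_of_injective φ ?_
    rintro ⟨W, hW, hWk⟩ ⟨W', hW', hWk'⟩ h
    have h3 : W.map U.mkQ = W'.map U.mkQ := congrArg Subtype.val h
    have h4 := congrArg (Submodule.comap U.mkQ) h3
    rw [Submodule.comap_map_mkQ, Submodule.comap_map_mkQ, sup_eq_right.2 hW,
      sup_eq_right.2 hW'] at h4
    exact Subtype.ext h4

/-- Double counting: if each member of a family of `k`-dimensional subspaces contains at least `X`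
of the `e`-dimensional subspaces `U i`, then the family is small. -/
lemma ncard_mul_le_of_contains {ι : Type*} [Finite ι] {U : ι → Submodule F V} {e k : ℕ}
    (hU : ∀ i, finrank F (U i) = e) {𝒲 : Set (Submodule F V)} (h𝒲 : ∀ W ∈ 𝒲, finrank F W = k)
    {X : ℝ} (hX : ∀ W ∈ 𝒲, X ≤ Nat.card {i // U i ≤ W}) :
    (𝒲.ncard : ℝ) * X ≤ Nat.card ι *
      ((Kq (Fintype.card F))⁻¹ * (Fintype.card F : ℝ) ^ ((k - e) * (finrank F V - k))) := by
  have : Fintype ι := Fintype.ofFinite _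
  have : Fintype 𝒲 := Fintype.ofFinite _
  let φ : (Σ W : 𝒲, {i // U i ≤ W.1}) ≃ (Σ i : ι, {W : 𝒲 // U i ≤ W.1}) :=
    { toFun := fun p => ⟨p.2.1, p.1, p.2.2⟩
      invFun := fun p => ⟨p.2.1, p.1, p.2.2⟩
      left_inv := fun _ => rfl
      right_inv := fun _ => rfl }
  have h := Nat.card_congr φ
  rw [Nat.card_sigma, Nat.card_sigma] at h
  calc (𝒲.ncard : ℝ) * X = ∑ W : 𝒲, X := by
        rw [Finset.sum_const, nsmul_eq_mul, Finset.card_univ, ← Nat.card_eq_fintype_card]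
        rfl
    _ ≤ ∑ W : 𝒲, (Nat.card {i // U i ≤ W.1} : ℝ) := Finset.sum_le_sum fun W _ => hX W.1 W.2
    _ = ∑ i : ι, (Nat.card {W : 𝒲 // U i ≤ W.1} : ℝ) := by exact_mod_cast h
    _ ≤ ∑ i : ι, ((Kq (Fintype.card F))⁻¹ *
          (Fintype.card F : ℝ) ^ ((k - e) * (finrank F V - k))) := by
        refine Finset.sum_le_sum fun i _ => le_trans ?_ (ncard_superspaces_le (hU i) k)
        norm_cast
        refine Nat.card_le_card_of_injective
          (fun W => (⟨W.1.1, W.2, h𝒲 _ W.1.2⟩ : {W : Submodule F V | U i ≤ W ∧ finrank F W = k})) ?_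
        intro W W' h
        exact Subtype.ext (Subtype.ext (congrArg (fun x => x.1) h))
    _ = _ := by
        rw [Finset.sum_const, nsmul_eq_mul, Finset.card_univ, ← Nat.card_eq_fintype_card]

/-- The number of `a`-dimensional subspaces of a subspace. -/
lemma card_subspaces_le (K : Submodule F V) (a : ℕ) :
    (Nat.card {S : Submodule F V // S ≤ K ∧ finrank F S = a} : ℝ) ≤
      (Kq (Fintype.card F))⁻¹ * (Fintype.card F : ℝ) ^ (a * (finrank F K - a)) := by
  refine le_trans ?_ (card_grassmannian_le (F := F) (V := K) a)
  norm_cast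
  refine Nat.card_le_card_of_injective (fun S => ⟨S.1.comap K.subtype, ?_⟩) ?_
  · rw [← Submodule.finrank_map_subtype_eq, Submodule.map_comap_subtype, inf_eq_right.2 S.2.1]
    exact S.2.2
  · intro S S' h
    have h1 := congrArg (Submodule.map K.subtype) (congrArg Subtype.val h)
    simp only [Submodule.map_comap_subtype, inf_eq_right.2 S.2.1, inf_eq_right.2 S'.2.1] at h1
    exact Subtype.ext h1

/-- A family of `k`-dimensional subspaces each of which meets `K` in dimension at least `a`. -/
lemma ncard_le_of_contains_subspace {K : Submodule F V} {a k : ℕ} {𝒲 : Set (Submodule F V)}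
    (h𝒲 : ∀ W ∈ 𝒲, finrank F W = k) (h : ∀ W ∈ 𝒲, ∃ S ≤ K, finrank F S = a ∧ S ≤ W) :
    (𝒲.ncard : ℝ) ≤ (Kq (Fintype.card F))⁻¹ ^ 2 *
      (Fintype.card F : ℝ) ^ (a * (finrank F K - a) + (k - a) * (finrank F V - k)) := by
  have hq : 2 ≤ Fintype.card F := Fintype.one_lt_card
  have hK := Kq_pos hq
  have h1 := ncard_mul_le_of_contains
    (U := fun S : {S : Submodule F V // S ≤ K ∧ finrank F S = a} => S.1) (e := a) (k := k)
    (fun S => S.2.2) h𝒲 (X := 1) (by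
      intro W hW
      obtain ⟨S, hS, hSa, hSW⟩ := h W hW
      have : Nonempty {i : {S : Submodule F V // S ≤ K ∧ finrank F S = a} // i.1 ≤ W} :=
        ⟨⟨⟨S, hS, hSa⟩, hSW⟩⟩
      exact_mod_cast Nat.card_pos)
  rw [mul_one] at h1
  refine h1.trans ((mul_le_mul_of_nonneg_right (card_subspaces_le K a) (by positivity)).trans
    (le_of_eq ?_))
  rw [pow_add]
  ring

lemma ncard_finrank_map_eq_mul_le (u : V →ₗ[F] V) {k s d : ℕ}
    (hd : d ≤ (finrank F (LinearMap.range u) - s) * (k - s)) :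
    (({W : Submodule F V | finrank F W = k ∧ finrank F (W.map u) = s} : Set _).ncard : ℝ) *
        (Fintype.card F : ℝ) ^ d ≤
      (Kq (Fintype.card F))⁻¹ ^ 2 * (Fintype.card F : ℝ) ^ (k * (finrank F V - k)) := by
  have hq : 2 ≤ Fintype.card F := Fintype.one_lt_card
  have hq1 : (1 : ℝ) ≤ Fintype.card F := by exact_mod_cast (by omega : 1 ≤ Fintype.card F)
  have hK := Kq_pos hq
  rcases ({W : Submodule F V | finrank F W = k ∧ finrank F (W.map u) = s} :
    Set _).eq_empty_or_nonempty with h | ⟨W₀, hW₀, hs₀⟩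
  · rw [h, Set.ncard_empty, Nat.cast_zero, zero_mul]
    positivity
  · have hker : ∀ W : Submodule F V, finrank F W = k → finrank F (W.map u) = s →
        finrank F (W ⊓ LinearMap.ker u : Submodule F V) = k - s := by
      intro W h1 h2
      have := finrank_map_add_finrank_inf_ker u W
      omega
    have h1 := ncard_le_of_contains_subspace
      (𝒲 := {W : Submodule F V | finrank F W = k ∧ finrank F (W.map u) = s})
      (K := LinearMap.ker u) (a := k - s) (fun W hW => hW.1)
      (fun W hW => ⟨W ⊓ LinearMap.ker u, inf_le_right, hker W hW.1 hW.2, inf_le_left⟩)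
    have h2 : finrank F (W₀.map u) ≤ finrank F (LinearMap.range u) :=
      Submodule.finrank_mono LinearMap.map_le_range
    have h3 : finrank F (W₀ ⊓ LinearMap.ker u : Submodule F V) ≤ finrank F (LinearMap.ker u) :=
      Submodule.finrank_mono inf_le_right
    have h4 := hker W₀ hW₀ hs₀
    have h5 := LinearMap.finrank_range_add_finrank_ker u
    have h6 := finrank_map_add_finrank_inf_ker u W₀
    refine (mul_le_mul_of_nonneg_right h1 (by positivity)).trans ?_
    rw [mul_assoc, ← pow_add]
    gcongr _ * ?_
    refine pow_le_pow_right₀ hq1 ((Nat.add_le_add_left hd _).trans (le_of_eq ?_))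
    generalize finrank F (LinearMap.range u) = r at *
    generalize finrank F (LinearMap.ker u) = κ at *
    generalize finrank F V = n at *
    obtain ⟨a, rfl⟩ : ∃ a, k = s + a := ⟨k - s, by omega⟩
    obtain ⟨p, rfl⟩ : ∃ p, r = s + p := ⟨r - s, by omega⟩
    obtain ⟨b, rfl⟩ : ∃ b, κ = a + b := ⟨κ - a, by omega⟩
    have e1 : s + a - s = a := by omega
    have e2 : a + b - a = b := by omega
    have e3 : s + a - a = s := by omega
    have e4 : s + p - s = p := by omega
    have e5 : n - (s + a) = p + b := by omega
    rw [e1, e2, e3, e4, e5]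
    ring

lemma ncard_invariant_finrank_map_eq_mul_le (u : V →ₗ[F] V) {k s d : ℕ}
    (hr : finrank F (LinearMap.range u) ≤ finrank F V - k)
    (hd : d ≤ s * (finrank F V - k - (finrank F (LinearMap.range u) - s))) :
    (({W : Submodule F V | finrank F W = k ∧ W.map u ≤ W ∧ finrank F (W.map u) = s} :
        Set _).ncard : ℝ) * (Fintype.card F : ℝ) ^ d ≤
      (Kq (Fintype.card F))⁻¹ ^ 2 * (Fintype.card F : ℝ) ^ (k * (finrank F V - k)) := by
  have hq : 2 ≤ Fintype.card F := Fintype.one_lt_card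
  have hq1 : (1 : ℝ) ≤ Fintype.card F := by exact_mod_cast (by omega : 1 ≤ Fintype.card F)
  have hK := Kq_pos hq
  rcases ({W : Submodule F V | finrank F W = k ∧ W.map u ≤ W ∧ finrank F (W.map u) = s} :
    Set _).eq_empty_or_nonempty with h | ⟨W₀, hW₀, hi₀, hs₀⟩
  · rw [h, Set.ncard_empty, Nat.cast_zero, zero_mul]
    positivity
  · have h1 := ncard_le_of_contains_subspace
      (𝒲 := {W : Submodule F V | finrank F W = k ∧ W.map u ≤ W ∧ finrank F (W.map u) = s})
      (K := LinearMap.range u) (a := s) (fun W hW => hW.1)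
      (fun W hW => ⟨W.map u, LinearMap.map_le_range, hW.2.2, hW.2.1⟩)
    have h2 : finrank F (W₀.map u) ≤ finrank F (LinearMap.range u) :=
      Submodule.finrank_mono LinearMap.map_le_range
    have h6 := finrank_map_add_finrank_inf_ker u W₀
    refine (mul_le_mul_of_nonneg_right h1 (by positivity)).trans ?_
    rw [mul_assoc, ← pow_add]
    gcongr _ * ?_
    refine pow_le_pow_right₀ hq1 ((Nat.add_le_add_left hd _).trans (le_of_eq ?_))
    generalize finrank F (LinearMap.range u) = r at *
    generalize finrank F V - k = l at *
    obtain ⟨a, rfl⟩ : ∃ a, k = s + a := ⟨k - s, by omega⟩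
    obtain ⟨p, rfl⟩ : ∃ p, r = s + p := ⟨r - s, by omega⟩
    obtain ⟨b, rfl⟩ : ∃ b, l = p + b := ⟨l - p, by omega⟩
    have e1 : s + a - s = a := by omega
    have e2 : s + p - s = p := by omega
    have e3 : p + b - p = b := by omega
    rw [e1, e2, e3]
    ring

end Counting

section IndependentImages

variable {F V : Type*} [Field F] [AddCommGroup V] [Module F V]

open Module

/-- The linear map sending a tuple `w` to `∑ i, (c (inl i) • w i + c (inr i) • g (w i))`. -/
def tupleRelation (g : V →ₗ[F] V) {j : ℕ} (c : Fin j ⊕ Fin j → F) : (Fin j → V) →ₗ[F] V :=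
  ∑ i, (c (Sum.inl i) • LinearMap.proj i + c (Sum.inr i) • g ∘ₗ LinearMap.proj i)

lemma tupleRelation_apply (g : V →ₗ[F] V) {j : ℕ} (c : Fin j ⊕ Fin j → F) (w : Fin j → V) :
    tupleRelation g c w = ∑ x, c x • (Sum.elim w (g ∘ w) : Fin j ⊕ Fin j → V) x := by
  simp [tupleRelation, Finset.sum_add_distrib]

lemma tupleRelation_single (g : V →ₗ[F] V) {j : ℕ} (c : Fin j ⊕ Fin j → F) (i : Fin j) (v : V) :
    tupleRelation g c (Pi.single i v) = c (Sum.inl i) • v + c (Sum.inr i) • g v := by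
  rw [tupleRelation, LinearMap.sum_apply, Finset.sum_eq_single i]
  · simp
  · intro b _ hb
    simp [Pi.single_eq_of_ne hb]
  · simp

lemma le_finrank_range_tupleRelation [FiniteDimensional F V] (g : V →ₗ[F] V) {t j : ℕ}
    (ht : ∀ a : F, t ≤ finrank F (LinearMap.range (g - a • LinearMap.id)))
    {c : Fin j ⊕ Fin j → F} (hc : c ≠ 0) :
    t ≤ finrank F (LinearMap.range (tupleRelation g c)) := by
  have key : ∃ i, c (Sum.inl i) ≠ 0 ∨ c (Sum.inr i) ≠ 0 := by
    by_contra! h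
    exact hc (funext fun x => by rcases x with i | i; exacts [(h i).1, (h i).2])
  obtain ⟨i, hi⟩ := key
  by_cases hb : c (Sum.inr i) = 0
  · have ha : c (Sum.inl i) ≠ 0 := by tauto
    refine (ht 0).trans (Submodule.finrank_mono ?_)
    rintro v -
    refine ⟨Pi.single i ((c (Sum.inl i))⁻¹ • v), ?_⟩
    rw [tupleRelation_single, hb, zero_smul, add_zero, smul_smul, mul_inv_cancel₀ ha, one_smul]
  · refine (ht (-(c (Sum.inl i) / c (Sum.inr i)))).trans (Submodule.finrank_mono ?_)
    rintro _ ⟨v, rfl⟩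
    refine ⟨Pi.single i ((c (Sum.inr i))⁻¹ • v), ?_⟩
    rw [tupleRelation_single, map_smul, smul_smul, smul_smul, mul_inv_cancel₀ hb]
    simp [div_eq_mul_inv, add_comm]

variable [Fintype F] [Finite V]

lemma pow_le_two_mul_card_independent (g : V →ₗ[F] V) {t j : ℕ}
    (ht : ∀ a : F, t ≤ finrank F (LinearMap.range (g - a • LinearMap.id))) (hj : 2 * j < t) :
    Fintype.card F ^ (j * finrank F V) ≤
      2 * Nat.card {w : Fin j → V //
        LinearIndependent F (Sum.elim w (g ∘ w) : Fin j ⊕ Fin j → V)} := by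
  classical
  have hq : 2 ≤ Fintype.card F := Fintype.one_lt_card
  have : Fintype V := Fintype.ofFinite _
  set q := Fintype.card F
  set n := finrank F V
  have hker : ∀ c : {c : Fin j ⊕ Fin j → F // c ≠ 0},
      Nat.card (LinearMap.ker (tupleRelation g c.1)) * q ^ t ≤ q ^ (j * n) := by
    intro c
    have h1 := LinearMap.finrank_range_add_finrank_ker (tupleRelation g c.1)
    have h2 := le_finrank_range_tupleRelation g ht c.2
    rw [Module.finrank_pi_fintype, Finset.sum_const, Finset.card_univ, Fintype.card_fin,
      smul_eq_mul] at h1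
    change _ = j * n at h1
    rw [Module.natCard_eq_pow_finrank (K := F), Nat.card_eq_fintype_card, ← pow_add]
    exact Nat.pow_le_pow_right (by omega) (by omega)
  have hbad : Nat.card {w : Fin j → V //
      ¬ LinearIndependent F (Sum.elim w (g ∘ w) : Fin j ⊕ Fin j → V)} * q ^ t ≤
      q ^ (2 * j) * q ^ (j * n) := by
    have h1 : ∀ w : {w : Fin j → V //
        ¬ LinearIndependent F (Sum.elim w (g ∘ w) : Fin j ⊕ Fin j → V)},
        ∃ c : {c : Fin j ⊕ Fin j → F // c ≠ 0}, w.1 ∈ LinearMap.ker (tupleRelation g c.1) := by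
      intro w
      have h2 := w.2
      rw [Fintype.not_linearIndependent_iff] at h2
      obtain ⟨c, hc, i, hi⟩ := h2
      refine ⟨⟨c, fun h => hi (by rw [h]; rfl)⟩, ?_⟩
      rw [LinearMap.mem_ker, tupleRelation_apply]
      exact hc
    choose c hc using h1
    have h3 := Nat.card_le_card_of_injective
      (fun w => (⟨c w, ⟨w.1, hc w⟩⟩ :
        Σ c : {c : Fin j ⊕ Fin j → F // c ≠ 0}, LinearMap.ker (tupleRelation g c.1)))
      (by
        intro w w' h
        exact Subtype.ext (congrArg (fun p : (Σ c : {c : Fin j ⊕ Fin j → F // c ≠ 0},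
          LinearMap.ker (tupleRelation g c.1)) => (p.2 : Fin j → V)) h))
    rw [Nat.card_sigma] at h3
    calc _ ≤ (∑ c : {c : Fin j ⊕ Fin j → F // c ≠ 0},
            Nat.card (LinearMap.ker (tupleRelation g c.1))) * q ^ t := by gcongr
      _ = ∑ c : {c : Fin j ⊕ Fin j → F // c ≠ 0},
            Nat.card (LinearMap.ker (tupleRelation g c.1)) * q ^ t := by rw [Finset.sum_mul]
      _ ≤ ∑ c : {c : Fin j ⊕ Fin j → F // c ≠ 0}, q ^ (j * n) :=
          Finset.sum_le_sum fun c _ => hker c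
      _ = Fintype.card {c : Fin j ⊕ Fin j → F // c ≠ 0} * q ^ (j * n) := by
          rw [Finset.sum_const, smul_eq_mul, Finset.card_univ]
      _ ≤ q ^ (2 * j) * q ^ (j * n) := by
          gcongr
          refine (Fintype.card_subtype_le _).trans (le_of_eq ?_)
          simp [q, two_mul]
  have htot : Nat.card {w : Fin j → V //
      LinearIndependent F (Sum.elim w (g ∘ w) : Fin j ⊕ Fin j → V)} + Nat.card {w : Fin j → V //
      ¬ LinearIndependent F (Sum.elim w (g ∘ w) : Fin j ⊕ Fin j → V)} = q ^ (j * n) := by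
    rw [← Nat.card_sum, Nat.card_congr (Equiv.sumCompl _), Nat.card_eq_fintype_card,
      Fintype.card_fun, Fintype.card_fin, Module.card_eq_pow_finrank (K := F), ← pow_mul, mul_comm]
  generalize Nat.card {w : Fin j → V //
      ¬ LinearIndependent F (Sum.elim w (g ∘ w) : Fin j ⊕ Fin j → V)} = B at *
  have h5 : B * 2 ≤ q ^ (j * n) := by
    have h6 : q ^ (2 * j) * (B * 2) ≤ q ^ (2 * j) * q ^ (j * n) := by
      calc q ^ (2 * j) * (B * 2) = B * (q ^ (2 * j) * 2) := by ring
        _ ≤ B * (q ^ (2 * j) * q) := by gcongr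
        _ = B * q ^ (2 * j + 1) := by rw [pow_succ]
        _ ≤ B * q ^ t := by gcongr <;> omega
        _ ≤ _ := hbad
    exact Nat.le_of_mul_le_mul_left h6 (by positivity)
  omega

lemma ncard_invariant_forall_le_mul_le (g : V →ₗ[F] V) {k t j : ℕ} (hj : 2 * j < t) :
    (({W : Submodule F V | finrank F W = k ∧ W.map g ≤ W ∧
        ∀ a : F, t ≤ finrank F (W.map (g - a • LinearMap.id))} : Set _).ncard : ℝ) *
        (Fintype.card F : ℝ) ^ (j * (finrank F V - k)) ≤
      2 * (Kq (Fintype.card F))⁻¹ * (Fintype.card F : ℝ) ^ (k * (finrank F V - k)) := by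
  classical
  have hq : 2 ≤ Fintype.card F := Fintype.one_lt_card
  have hK := Kq_pos hq
  rcases ({W : Submodule F V | finrank F W = k ∧ W.map g ≤ W ∧
        ∀ a : F, t ≤ finrank F (W.map (g - a • LinearMap.id))} :
    Set _).eq_empty_or_nonempty with h | ⟨W₀, hW₀, hi₀, hs₀⟩
  · rw [h, Set.ncard_empty, Nat.cast_zero, zero_mul]
    positivity
  have hkn : k ≤ finrank F V := hW₀ ▸ Submodule.finrank_le _
  have htk : t ≤ k := (hs₀ 0).trans (hW₀ ▸ Submodule.finrank_map_le _ _)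
  have hq0 : (0 : ℝ) < Fintype.card F := by positivity
  have h1 := ncard_mul_le_of_contains
    (ι := {w : Fin j → V // LinearIndependent F (Sum.elim w (g ∘ w) : Fin j ⊕ Fin j → V)})
    (U := fun w => Submodule.span F (Set.range (Sum.elim w.1 (g ∘ w.1) : Fin j ⊕ Fin j → V)))
    (e := 2 * j) (k := k)
    (fun w => by rw [finrank_span_eq_card w.2]; simp [two_mul])
    (𝒲 := {W : Submodule F V | finrank F W = k ∧ W.map g ≤ W ∧
        ∀ a : F, t ≤ finrank F (W.map (g - a • LinearMap.id))}) (fun W hW => hW.1)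
    (X := (Fintype.card F : ℝ) ^ (j * k) / 2) (by
      rintro W ⟨hW, hi, hs⟩
      have hmem : ∀ x ∈ W, g x ∈ W := fun x hx => hi ⟨x, hx, rfl⟩
      have h2 := pow_le_two_mul_card_independent (g.restrict hmem) (t := t) (j := j) (by
        intro a
        refine (hs a).trans (le_of_eq ?_)
        rw [← Submodule.finrank_map_subtype_eq, ← LinearMap.range_comp,
          ← LinearMap.range_domRestrict]
        rfl) hj
      rw [hW] at h2
      have h3 := Nat.card_le_card_of_injective
        (α := {w : Fin j → W // LinearIndependent F
          (Sum.elim w (g.restrict hmem ∘ w) : Fin j ⊕ Fin j → W)})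
        (β := {i : {w : Fin j → V //
            LinearIndependent F (Sum.elim w (g ∘ w) : Fin j ⊕ Fin j → V)} //
          Submodule.span F (Set.range (Sum.elim i.1 (g ∘ i.1) : Fin j ⊕ Fin j → V)) ≤ W})
        (fun w => ⟨⟨fun i => (w.1 i : V), by
            have h4 := w.2.map' W.subtype (Submodule.ker_subtype _)
            rw [Sum.comp_elim] at h4
            exact h4⟩, by
            rw [Submodule.span_le]
            rintro _ ⟨i | i, rfl⟩
            exacts [(w.1 i).2, hmem _ (w.1 i).2]⟩)
        (by
          intro w w' h
          have h4 := congrArg (fun x => x.1.1) h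
          exact Subtype.ext (funext fun i => Subtype.ext (congrFun h4 i)))
      have h5 := (h2.trans (Nat.mul_le_mul_left 2 h3))
      have h6 : ((Fintype.card F : ℝ)) ^ (j * k) ≤ 2 * (Nat.card {i : {w : Fin j → V //
            LinearIndependent F (Sum.elim w (g ∘ w) : Fin j ⊕ Fin j → V)} //
          Submodule.span F (Set.range (Sum.elim i.1 (g ∘ i.1) : Fin j ⊕ Fin j → V)) ≤ W} : ℝ) := by
        exact_mod_cast h5
      linarith)
  have h7 : (Nat.card {w : Fin j → V //
      LinearIndependent F (Sum.elim w (g ∘ w) : Fin j ⊕ Fin j → V)} : ℝ) ≤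
      (Fintype.card F : ℝ) ^ (j * finrank F V) := by
    have : Fintype V := Fintype.ofFinite _
    have h8 := Nat.card_le_card_of_injective (Subtype.val : {w : Fin j → V //
      LinearIndependent F (Sum.elim w (g ∘ w) : Fin j ⊕ Fin j → V)} → _) Subtype.val_injective
    rw [Nat.card_eq_fintype_card (α := Fin j → V), Fintype.card_fun, Fintype.card_fin,
      Module.card_eq_pow_finrank (K := F), ← pow_mul, mul_comm] at h8
    exact_mod_cast h8
  have h9 := h1.trans (mul_le_mul_of_nonneg_right h7 (by positivity))
  generalize Set.ncard _ = N at *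
  generalize finrank F V = n at *
  obtain ⟨a, rfl⟩ : ∃ a, k = 2 * j + a := ⟨k - 2 * j, by omega⟩
  obtain ⟨l, rfl⟩ : ∃ l, n = 2 * j + a + l := ⟨n - (2 * j + a), by omega⟩
  rw [Nat.add_sub_cancel_left, Nat.add_sub_cancel_left] at *
  have hp : (0 : ℝ) < (Fintype.card F : ℝ) ^ (j * (2 * j + a)) := by positivity
  refine le_of_mul_le_mul_left ?_ hp
  have hp' : (0 : ℝ) < 2 * (Fintype.card F : ℝ) ^ (j * l) := by positivity
  have h10 := mul_le_mul_of_nonneg_left h9 hp'.le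
  calc _ = _ := by ring
    _ ≤ _ := h10
    _ = _ := by ring

end IndependentImages

section InvariantBound

open Module

lemma ncard_mul_le_of_subset_biUnion {α ι : Type*} [Finite α] {S : Set α} {I : Finset ι}
    {T : ι → Set α} (hS : S ⊆ ⋃ i ∈ I, T i) {x B : ℝ} (hx : 0 ≤ x)
    (hT : ∀ i ∈ I, ((T i).ncard : ℝ) * x ≤ B) : (S.ncard : ℝ) * x ≤ I.card * B := by
  have h1 : S.ncard ≤ ∑ i ∈ I, (T i).ncard :=
    (Set.ncard_le_ncard hS (Set.toFinite _)).trans (I.set_ncard_biUnion_le T)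
  calc (S.ncard : ℝ) * x ≤ (∑ i ∈ I, ((T i).ncard : ℝ)) * x := by
        gcongr
        exact_mod_cast h1
    _ = ∑ i ∈ I, ((T i).ncard : ℝ) * x := Finset.sum_mul _ _ _
    _ ≤ ∑ i ∈ I, B := Finset.sum_le_sum hT
    _ = I.card * B := by rw [Finset.sum_const, nsmul_eq_mul]

variable {F V : Type*} [Field F] [AddCommGroup V] [Module F V]

lemma map_sub_smul_id_le {g : V →ₗ[F] V} {W : Submodule F V} (h : W.map g ≤ W) (a : F) :
    W.map (g - a • LinearMap.id) ≤ W := by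
  rintro _ ⟨x, hx, rfl⟩
  exact W.sub_mem (h ⟨x, hx, rfl⟩) (W.smul_mem a hx)

variable [Fintype F] [Finite V]

/-- A linear map at distance `r` from the scalars has few invariant subspaces of a given dimension
close to the middle one. -/
lemma ncard_invariant_mul_le (g : V →ₗ[F] V) {n k r : ℕ} (hn : finrank F V = n) (hn' : 100 ≤ n)
    (hk : 2 * n ≤ 5 * k) (hk' : 5 * k ≤ 3 * n)
    (hr : ∀ a : F, r ≤ finrank F (LinearMap.range (g - a • LinearMap.id)))
    (hr' : ∃ a : F, finrank F (LinearMap.range (g - a • LinearMap.id)) = r) :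
    (({W : Submodule F V | finrank F W = k ∧ W.map g ≤ W} : Set _).ncard : ℝ) *
        (Fintype.card F : ℝ) ^ (r * (n / 100)) ≤
      (Fintype.card F * (n + 1) + 2) * ((Kq (Fintype.card F))⁻¹ ^ 2 *
        (Fintype.card F : ℝ) ^ (k * (n - k))) := by
  have hq : 2 ≤ Fintype.card F := Fintype.one_lt_card
  have hq1 : (1 : ℝ) ≤ Fintype.card F := by exact_mod_cast (by omega : 1 ≤ Fintype.card F)
  have hK := Kq_pos hq
  have hK1 : 1 ≤ (Kq (Fintype.card F))⁻¹ := (one_le_inv₀ hK).2 (Kq_le_one hq)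
  obtain ⟨h, hh⟩ : ∃ h, h = n / 100 := ⟨_, rfl⟩
  rw [← hh]
  have hh1 : 1 ≤ h := by omega
  have hh2 : 100 * h ≤ n := by omega
  set D := (Kq (Fintype.card F))⁻¹ ^ 2 * (Fintype.card F : ℝ) ^ (k * (n - k)) with hD
  have hD0 : 0 ≤ D := by positivity
  have hx : (0 : ℝ) ≤ (Fintype.card F : ℝ) ^ (r * h) := by positivity
  have hrn : r ≤ n := hn ▸ (hr 0).trans (Submodule.finrank_le _)
  have mul_bound : ∀ x y : ℕ, r ≤ 2 * x → 2 * h ≤ y → r * h ≤ x * y := fun x y h1 h2 =>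
    calc r * h ≤ 2 * x * h := Nat.mul_le_mul_right _ h1
      _ = x * (2 * h) := by ring
      _ ≤ x * y := Nat.mul_le_mul_left _ h2
  by_cases hcase : r ≤ 30 * h
  · obtain ⟨a, ha⟩ := hr'
    refine (ncard_mul_le_of_subset_biUnion (I := Finset.range (r + 1))
      (T := fun s => {W : Submodule F V | finrank F W = k ∧ W.map (g - a • LinearMap.id) ≤ W ∧
        finrank F (W.map (g - a • LinearMap.id)) = s}) ?_ hx (B := D) ?_).trans ?_
    · rintro W ⟨hW, hi⟩
      have h1 : finrank F (W.map (g - a • LinearMap.id)) ≤ r :=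
        ha ▸ Submodule.finrank_mono LinearMap.map_le_range
      simp only [Set.mem_iUnion, Finset.mem_range]
      exact ⟨_, Nat.lt_succ_of_le h1, hW, map_sub_smul_id_le hi a, rfl⟩
    · intro s hs
      have hs' : s ≤ r := Nat.lt_succ_iff.1 (Finset.mem_range.1 hs)
      rw [hD, ← hn]
      by_cases hsr : 2 * s ≤ r
      · refine (mul_le_mul_of_nonneg_right ?_ hx).trans
          (ncard_finrank_map_eq_mul_le (g - a • LinearMap.id) (k := k) (s := s) ?_)
        · exact Nat.cast_le.2 (Set.ncard_le_ncard (fun W hW => ⟨hW.1, hW.2.2⟩) (Set.toFinite _))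
        · rw [ha]
          exact mul_bound _ _ (by omega) (by omega)
      · refine ncard_invariant_finrank_map_eq_mul_le (g - a • LinearMap.id) ?_ ?_
        · rw [ha, hn]
          omega
        · rw [ha, hn]
          exact mul_bound _ _ (by omega) (by omega)
    · gcongr
      rw [Finset.card_range]
      have h2 : (r : ℝ) ≤ n := by exact_mod_cast hrn
      push_cast
      nlinarith
  · have hsub : {W : Submodule F V | finrank F W = k ∧ W.map g ≤ W} ⊆
        {W : Submodule F V | ∃ a : F, finrank F W = k ∧
          finrank F (W.map (g - a • LinearMap.id)) < 9 * h} ∪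
        {W : Submodule F V | finrank F W = k ∧ W.map g ≤ W ∧
          ∀ a : F, 9 * h ≤ finrank F (W.map (g - a • LinearMap.id))} := by
      rintro W ⟨hW, hi⟩
      by_cases h1 : ∃ a : F, finrank F (W.map (g - a • LinearMap.id)) < 9 * h
      · obtain ⟨a, ha⟩ := h1
        exact Or.inl ⟨a, hW, ha⟩
      · push Not at h1
        exact Or.inr ⟨hW, hi, h1⟩
    have hcard := (Set.ncard_le_ncard hsub (Set.toFinite _)).trans (Set.ncard_union_le _ _)
    have hA := ncard_mul_le_of_subset_biUnion (I := (Finset.univ : Finset F) ×ˢ Finset.range (9 * h))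
      (S := {W : Submodule F V | ∃ a : F, finrank F W = k ∧
          finrank F (W.map (g - a • LinearMap.id)) < 9 * h})
      (T := fun p => {W : Submodule F V | finrank F W = k ∧
        finrank F (W.map (g - p.1 • LinearMap.id)) = p.2})
      (by
        rintro W ⟨a, hW, ha⟩
        simp only [Set.mem_iUnion]
        exact ⟨(a, _), by simpa using ha, hW, rfl⟩) hx (B := D) (by
        rintro ⟨a, s⟩ hs
        have hs' : s < 9 * h := by simpa using hs
        rw [hD, ← hn]
        refine ncard_finrank_map_eq_mul_le (g - a • LinearMap.id) ?_
        have := hr a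
        exact mul_bound _ _ (by omega) (by omega))
    have hC := ncard_invariant_forall_le_mul_le g (k := k) (t := 9 * h) (j := 4 * h) (by omega)
    rw [hn] at hC
    have hexp : r * h ≤ 4 * h * (n - k) :=
      calc r * h ≤ (4 * (n - k)) * h := Nat.mul_le_mul_right _ (by omega)
        _ = 4 * h * (n - k) := by ring
    have hC' := (mul_le_mul_of_nonneg_left (pow_le_pow_right₀ hq1 hexp) (Nat.cast_nonneg _)).trans hC
    have hC2 : 2 * (Kq (Fintype.card F))⁻¹ * (Fintype.card F : ℝ) ^ (k * (n - k)) ≤ 2 * D := by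
      rw [hD, mul_assoc]
      gcongr
      nlinarith
    have hcount : ((((Finset.univ : Finset F) ×ˢ Finset.range (9 * h)).card : ℕ) : ℝ) ≤
        Fintype.card F * (n + 1) := by
      rw [Finset.card_product, Finset.card_range, Finset.card_univ]
      push_cast
      gcongr
      exact_mod_cast (by omega : 9 * h ≤ n + 1)
    have hsum := mul_le_mul_of_nonneg_right (Nat.cast_le (α := ℝ).2 hcard) hx
    rw [Nat.cast_add, add_mul] at hsum
    have hA' := hA.trans (mul_le_mul_of_nonneg_right hcount hD0)
    linarith

end InvariantBound

section Monomial

open Module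

variable {F : Type} [Field F] {n : ℕ}

/-- The monomial linear map `v ↦ (d i * v (σ i))_i`. -/
def monomialMap (p : Equiv.Perm (Fin n) × (Fin n → Fˣ)) : (Fin n → F) →ₗ[F] (Fin n → F) where
  toFun v i := p.2 i * v (p.1 i)
  map_add' v w := by ext i; simp [mul_add]
  map_smul' a v := by ext i; simp [mul_left_comm]

lemma monomialMap_apply (p : Equiv.Perm (Fin n) × (Fin n → Fˣ)) (v : Fin n → F) (i : Fin n) :
    monomialMap p v i = p.2 i * v (p.1 i) := rfl

lemma monomialMap_injective :
    Function.Injective (monomialMap : Equiv.Perm (Fin n) × (Fin n → Fˣ) → _) := by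
  rintro ⟨σ, d⟩ ⟨σ', d'⟩ h
  have h1 : ∀ i, σ i = σ' i ∧ d i = d' i := by
    intro i
    have h2 := congrFun (LinearMap.congr_fun h (Pi.single (σ i) 1)) i
    simp only [monomialMap_apply, Pi.single_eq_same, mul_one] at h2
    by_cases h3 : σ' i = σ i
    · rw [h3, Pi.single_eq_same, mul_one] at h2
      exact ⟨h3.symm, Units.ext h2⟩
    · rw [Pi.single_eq_of_ne h3, mul_zero] at h2
      exact absurd h2 (d i).ne_zero
  exact Prod.ext (Equiv.ext fun i => (h1 i).1) (funext fun i => (h1 i).2)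

/-- The indices at which a monomial map differs from the scalar map `a`. -/
def monomialDefect [DecidableEq F] (p : Equiv.Perm (Fin n) × (Fin n → Fˣ)) (a : F) :
    Finset (Fin n) :=
  Finset.univ.filter fun i => ((p.1 i, (p.2 i : F)) : Fin n × F) ≠ (i, a)

lemma card_monomialDefect_le [DecidableEq F] (p : Equiv.Perm (Fin n) × (Fin n → Fˣ)) (a : F) :
    (monomialDefect p a).card ≤
      2 * finrank F (LinearMap.range (monomialMap p - a • LinearMap.id)) := by
  classical
  set u := monomialMap p - a • LinearMap.id with hu
  have hu_apply : ∀ v i, u v i = p.2 i * v (p.1 i) - a * v i := fun v i => by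
    simp [hu, monomialMap_apply]
  obtain ⟨b, hb, hspan, hli⟩ := exists_linearIndependent F
    (Set.range fun j : Fin n => u (Pi.single j 1))
  have hbfin : b.Finite := (Set.finite_range _).subset hb
  have : Fintype b := hbfin.fintype
  have hrange : Submodule.span F b = LinearMap.range u := by
    rw [hspan, Set.range_comp' u (fun j : Fin n => (Pi.single j 1 : Fin n → F)),
      Submodule.span_image]
    have : Submodule.span F (Set.range fun j : Fin n => (Pi.single j 1 : Fin n → F)) = ⊤ := by
      have h := (Pi.basisFun F (Fin n)).span_eq
      convert h using 3
      ext j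
      simp
    rw [this, Submodule.map_top]
  have hcard : hbfin.toFinset.card = finrank F (LinearMap.range u) := by
    rw [← hrange, finrank_span_set_eq_card hli, Set.Finite.toFinset_eq_toFinset]
  have hsub : monomialDefect p a ⊆
      hbfin.toFinset.biUnion fun x => Finset.univ.filter fun i => x i ≠ 0 := by
    intro i hi
    by_contra hcon
    have h0 : ∀ x ∈ b, x i = 0 := by
      intro x hx
      by_contra h
      exact hcon (Finset.mem_biUnion.2 ⟨x, hbfin.mem_toFinset.2 hx, by simpa using h⟩)
    have h1 : LinearMap.range u ≤ LinearMap.ker (LinearMap.proj (R := F) (φ := fun _ => F) i) := by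
      rw [← hrange, Submodule.span_le]
      intro x hx
      exact h0 x hx
    have h2 : ∀ v, u v i = 0 := fun v => h1 ⟨v, rfl⟩
    have h3 := h2 (Pi.single (p.1 i) 1)
    rw [hu_apply, Pi.single_eq_same, mul_one] at h3
    have hi' : ((p.1 i, (p.2 i : F)) : Fin n × F) ≠ (i, a) := (Finset.mem_filter.1 hi).2
    by_cases h4 : i = p.1 i
    · rw [← h4, Pi.single_eq_same, mul_one, sub_eq_zero] at h3
      exact hi' (by rw [← h4, h3])
    · rw [Pi.single_eq_of_ne h4, mul_zero, sub_zero] at h3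
      exact (p.2 i).ne_zero h3
  refine (Finset.card_le_card hsub).trans ?_
  rw [← hcard, mul_comm]
  refine Finset.card_biUnion_le_card_mul _ _ _ fun x hx => ?_
  obtain ⟨j, rfl⟩ := hb (hbfin.mem_toFinset.1 hx)
  refine (Finset.card_le_card (t := {p.1.symm j, j}) ?_).trans Finset.card_le_two
  intro i hi
  have hi' := (Finset.mem_filter.1 hi).2
  simp only [hu_apply] at hi'
  by_contra h
  simp only [Finset.mem_insert, Finset.mem_singleton, not_or] at h
  refine hi' ?_
  rw [Pi.single_eq_of_ne h.2, Pi.single_eq_of_ne, mul_zero, mul_zero, sub_zero]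
  rintro rfl
  exact h.1 (by simp)

/-- The number of functions differing from a given one in at most `m` places. -/
lemma card_functions_near_le {α β : Type*} [Fintype α] [Fintype β] [DecidableEq α] [DecidableEq β]
    [Nonempty α] (b : α → β) (m : ℕ) :
    (Finset.univ.filter fun f : α → β => (Finset.univ.filter fun i => f i ≠ b i).card ≤ m).card ≤
      (Fintype.card α * Fintype.card β) ^ m := by
  induction m with
  | zero =>
    rw [pow_zero, Finset.card_le_one]
    have h : ∀ f ∈ (Finset.univ.filter fun f : α → β =>
        (Finset.univ.filter fun i => f i ≠ b i).card ≤ 0), f = b := by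
      intro f hf
      simpa [funext_iff, Finset.filter_eq_empty_iff] using hf
    intro f hf g hg
    rw [h f hf, h g hg]
  | succ m ih =>
    set S := (Finset.univ.filter fun f : α → β => (Finset.univ.filter fun i => f i ≠ b i).card ≤ m)
    have hsub : (Finset.univ.filter fun f : α → β =>
        (Finset.univ.filter fun i => f i ≠ b i).card ≤ m + 1) ⊆
        (S ×ˢ (Finset.univ : Finset (α × β))).image fun p => Function.update p.1 p.2.1 p.2.2 := by
      intro f hf
      have hf' := (Finset.mem_filter.1 hf).2
      obtain ⟨i, hi⟩ : ∃ i : α, f i ≠ b i ∨ f = b := by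
        by_cases h : f = b
        · exact ⟨Classical.arbitrary α, Or.inr h⟩
        · obtain ⟨i, hi⟩ := Function.ne_iff.1 h
          exact ⟨i, Or.inl hi⟩
      refine Finset.mem_image.2 ⟨(Function.update f i (b i), i, f i), ?_, by simp⟩
      refine Finset.mem_product.2 ⟨Finset.mem_filter.2 ⟨Finset.mem_univ _, ?_⟩, Finset.mem_univ _⟩
      rcases hi with hi | rfl
      · have h1 : (Finset.univ.filter fun x => Function.update f i (b i) x ≠ b x) ⊆
            (Finset.univ.filter fun x => f x ≠ b x).erase i := by
          intro x hx
          by_cases hxi : x = i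
          · subst hxi
            simp at hx
          · simpa [hxi] using hx
        refine (Finset.card_le_card h1).trans ?_
        rw [Finset.card_erase_of_mem (by simpa using hi)]
        omega
      · simp
    refine (Finset.card_le_card hsub).trans (Finset.card_image_le.trans ?_)
    rw [Finset.card_product, Finset.card_univ, Fintype.card_prod, pow_succ]
    exact Nat.mul_le_mul_right _ ih

variable [Fintype F]

/-- The minimal rank of a difference of a monomial map and a scalar. -/
noncomputable def scalarDistance (p : Equiv.Perm (Fin n) × (Fin n → Fˣ)) : ℕ :=
  ⨅ a : F, finrank F (LinearMap.range (monomialMap p - a • LinearMap.id))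

omit [Fintype F] in
lemma scalarDistance_le (p : Equiv.Perm (Fin n) × (Fin n → Fˣ)) (a : F) :
    scalarDistance p ≤ finrank F (LinearMap.range (monomialMap p - a • LinearMap.id)) :=
  ciInf_le' _ a

lemma exists_eq_scalarDistance (p : Equiv.Perm (Fin n) × (Fin n → Fˣ)) :
    ∃ a : F, finrank F (LinearMap.range (monomialMap p - a • LinearMap.id)) = scalarDistance p :=
  exists_eq_ciInf_of_finite

open scoped Classical in
lemma card_scalarDistance_le (hn : 0 < n) (r : ℕ) :
    (Finset.univ.filter fun p : Equiv.Perm (Fin n) × (Fin n → Fˣ) =>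
      scalarDistance p = r).card ≤
      Fintype.card F * (n * (n * Fintype.card F)) ^ (2 * r) := by
  have : Nonempty (Fin n) := ⟨⟨0, hn⟩⟩
  let near : F → Finset (Fin n → Fin n × F) := fun a => Finset.univ.filter fun f =>
    (Finset.univ.filter fun i => f i ≠ (i, a)).card ≤ 2 * r
  have hnear : ∀ a ∈ (Finset.univ : Finset F),
      (near a).card ≤ (n * (n * Fintype.card F)) ^ (2 * r) := by
    intro a _
    have := card_functions_near_le (fun i : Fin n => ((i, a) : Fin n × F)) (2 * r)
    simpa [near] using this
  refine le_trans (Finset.card_le_card_of_injOn (t := Finset.univ.biUnion near)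
    (fun p i => ((p.1 i, (p.2 i : F)) : Fin n × F)) ?_ ?_)
    (Finset.card_biUnion_le_card_mul _ _ _ hnear)
  · intro p hp
    have hp' : scalarDistance p = r := by simpa using hp
    obtain ⟨a, ha⟩ := exists_eq_scalarDistance p
    have h := card_monomialDefect_le p a
    rw [ha, hp'] at h
    simp only [Finset.coe_biUnion, Set.mem_iUnion]
    exact ⟨a, by simp, by simpa [near, monomialDefect] using h⟩
  · rintro ⟨σ, d⟩ _ ⟨σ', d'⟩ _ h
    have h1 : ∀ i, σ i = σ' i ∧ (d i : F) = d' i := fun i => by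
      simpa using congrFun h i
    exact Prod.ext (Equiv.ext fun i => (h1 i).1) (funext fun i => Units.ext (h1 i).2)

lemma scalarDistance_eq_zero_iff (p : Equiv.Perm (Fin n) × (Fin n → Fˣ)) (hn : 0 < n) :
    scalarDistance p = 0 ↔ ∃ a : Fˣ, p = (1, fun _ => a) := by
  classical
  constructor
  · intro h
    obtain ⟨a, ha⟩ := exists_eq_scalarDistance p
    have h1 := card_monomialDefect_le p a
    rw [ha, h, mul_zero, Nat.le_zero, Finset.card_eq_zero] at h1
    have h2 : ∀ i, p.1 i = i ∧ (p.2 i : F) = a := by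
      intro i
      by_contra hcon
      have : i ∈ monomialDefect p a := by simpa [monomialDefect] using hcon
      simp [h1] at this
    refine ⟨p.2 ⟨0, hn⟩, Prod.ext (Equiv.ext fun i => (h2 i).1) (funext fun i => Units.ext ?_)⟩
    rw [(h2 i).2, (h2 _).2]
  · rintro ⟨a, rfl⟩
    refine Nat.le_zero.1 ((scalarDistance_le _ (a : F)).trans (le_of_eq ?_))
    have : monomialMap ((1 : Equiv.Perm (Fin n)), fun _ : Fin n => a) -
        (a : F) • LinearMap.id = 0 := by
      ext v i
      simp [monomialMap_apply]
    rw [this, LinearMap.range_zero, finrank_bot]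

open scoped Classical in
lemma card_scalarDistance_eq_zero (hn : 0 < n) :
    (Finset.univ.filter fun p : Equiv.Perm (Fin n) × (Fin n → Fˣ) =>
      scalarDistance p = 0).card = Fintype.card F - 1 := by
  rw [← Fintype.card_units, ← Finset.card_univ]
  symm
  refine Finset.card_bij (fun a _ => (1, fun _ => a)) ?_ ?_ ?_
  · intro a _
    simpa using (scalarDistance_eq_zero_iff _ hn).2 ⟨a, rfl⟩
  · intro a _ b _ h
    exact congrFun (congrArg Prod.snd h) ⟨0, hn⟩
  · intro p hp
    obtain ⟨a, ha⟩ := (scalarDistance_eq_zero_iff p hn).1 (by simpa using hp)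
    exact ⟨a, Finset.mem_univ _, ha.symm⟩

end Monomial

section Burnside

open Module

variable {F : Type} [Field F] {n : ℕ}

/-- The inverse of a monomial transformation. -/
def monomialInv (p : Equiv.Perm (Fin n) × (Fin n → Fˣ)) : Equiv.Perm (Fin n) × (Fin n → Fˣ) :=
  (p.1⁻¹, fun i => (p.2 (p.1.symm i))⁻¹)

lemma monomialMap_comp_inv (p : Equiv.Perm (Fin n) × (Fin n → Fˣ)) :
    monomialMap p ∘ₗ monomialMap (monomialInv p) = LinearMap.id := by
  ext v i
  simp [monomialMap_apply, monomialInv]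

lemma monomialMap_inv_comp (p : Equiv.Perm (Fin n) × (Fin n → Fˣ)) :
    monomialMap (monomialInv p) ∘ₗ monomialMap p = LinearMap.id := by
  ext v i
  simp [monomialMap_apply, monomialInv]

/-- The invertible matrix of a monomial transformation. -/
def monomialGL (p : Equiv.Perm (Fin n) × (Fin n → Fˣ)) : GL (Fin n) F where
  val := LinearMap.toMatrix' (monomialMap p)
  inv := LinearMap.toMatrix' (monomialMap (monomialInv p))
  val_inv := by rw [← LinearMap.toMatrix'_comp, monomialMap_comp_inv, LinearMap.toMatrix'_id]
  inv_val := by rw [← LinearMap.toMatrix'_comp, monomialMap_inv_comp, LinearMap.toMatrix'_id]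

lemma toLin'_monomialGL (p : Equiv.Perm (Fin n) × (Fin n → Fˣ)) :
    Matrix.toLin' (monomialGL p : Matrix (Fin n) (Fin n) F) = monomialMap p :=
  Matrix.toLin'_toMatrix' _

lemma eq_monomialGL_iff (p : Equiv.Perm (Fin n) × (Fin n → Fˣ)) (M : GL (Fin n) F) :
    M = monomialGL p ↔ Matrix.toLin' (M : Matrix (Fin n) (Fin n) F) = monomialMap p := by
  rw [← toLin'_monomialGL, (Matrix.toLin' (R := F)).injective.eq_iff, Units.ext_iff]

lemma monomialGL_injective :
    Function.Injective (monomialGL : Equiv.Perm (Fin n) × (Fin n → Fˣ) → GL (Fin n) F) := by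
  intro p p' h
  apply monomialMap_injective
  rw [← toLin'_monomialGL, h, toLin'_monomialGL]

lemma perm_eq_monomialGL {M : GL (Fin n) F} {σ : Equiv.Perm (Fin n)}
    (h : (M : Matrix (Fin n) (Fin n) F) = σ.permMatrix F) : M = monomialGL (σ, 1) := by
  rw [eq_monomialGL_iff, h]
  refine LinearMap.ext fun v => funext fun i => ?_
  rw [Matrix.toLin'_apply, Matrix.permMatrix_mulVec, monomialMap_apply]
  simp

lemma diagonal_eq_monomialGL {M : GL (Fin n) F} {d : Fin n → Fˣ}
    (h : (M : Matrix (Fin n) (Fin n) F) = Matrix.diagonal fun i => (d i : F)) :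
    M = monomialGL (1, d) := by
  rw [eq_monomialGL_iff, h]
  refine LinearMap.ext fun v => funext fun i => ?_
  rw [Matrix.toLin'_apply, Matrix.mulVec_diagonal, monomialMap_apply]
  simp

lemma monomialGL_mul (p p' : Equiv.Perm (Fin n) × (Fin n → Fˣ)) :
    (monomialGL p * monomialGL p' : GL (Fin n) F) =
      monomialGL (p.1.trans p'.1, fun i => p.2 i * p'.2 (p.1 i)) := by
  rw [eq_monomialGL_iff, Units.val_mul, Matrix.toLin'_mul, toLin'_monomialGL, toLin'_monomialGL]
  refine LinearMap.ext fun v => funext fun i => ?_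
  simp [monomialMap_apply, mul_assoc]

lemma monomialGL_inv (p : Equiv.Perm (Fin n) × (Fin n → Fˣ)) :
    (monomialGL p : GL (Fin n) F)⁻¹ = monomialGL (monomialInv p) :=
  Units.ext rfl

lemma mem_MonomialGroup_iff (M : GL (Fin n) F) :
    M ∈ MonomialGroup F n ↔ ∃ p, monomialGL p = M := by
  constructor
  · intro h
    induction h using Subgroup.closure_induction with
    | mem M hM =>
      rcases hM with ⟨σ, hσ⟩ | ⟨d, hd⟩
      · exact ⟨_, (perm_eq_monomialGL hσ).symm⟩
      · have hdet : (M : Matrix (Fin n) (Fin n) F).det ≠ 0 :=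
          ((Matrix.isUnit_iff_isUnit_det _).1 M.isUnit).ne_zero
        rw [hd, Matrix.det_diagonal, Finset.prod_ne_zero_iff] at hdet
        exact ⟨_, (diagonal_eq_monomialGL
          (d := fun i => Units.mk0 (d i) (hdet i (Finset.mem_univ i))) hd).symm⟩
    | one => exact ⟨_, (perm_eq_monomialGL (σ := 1) (by simp)).symm⟩
    | mul M M' _ _ ih ih' =>
      obtain ⟨p, rfl⟩ := ih
      obtain ⟨p', rfl⟩ := ih'
      exact ⟨_, (monomialGL_mul p p').symm⟩
    | inv M _ ih =>
      obtain ⟨p, rfl⟩ := ih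
      exact ⟨_, (monomialGL_inv p).symm⟩
  · rintro ⟨p, rfl⟩
    have h1 : (monomialGL p : GL (Fin n) F) = monomialGL (1, p.2) * monomialGL (p.1, 1) := by
      rw [monomialGL_mul]
      congr 1
      exact Prod.ext rfl (by simp)
    rw [h1]
    refine mul_mem (Subgroup.subset_closure (Or.inr ⟨fun i => p.2 i, ?_⟩))
      (Subgroup.subset_closure (Or.inl ⟨p.1, ?_⟩))
    · apply (Matrix.toLin' (R := F)).injective
      rw [toLin'_monomialGL]
      refine LinearMap.ext fun v => funext fun i => ?_
      rw [Matrix.toLin'_apply, Matrix.mulVec_diagonal, monomialMap_apply]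
      simp
    · apply (Matrix.toLin' (R := F)).injective
      rw [toLin'_monomialGL]
      refine LinearMap.ext fun v => funext fun i => ?_
      rw [Matrix.toLin'_apply, Matrix.permMatrix_mulVec, monomialMap_apply]
      simp

/-- The monomial group is parametrised by pairs of a permutation and a tuple of units. -/
noncomputable def monomialEquiv :
    (Equiv.Perm (Fin n) × (Fin n → Fˣ)) ≃ MonomialGroup F n :=
  Equiv.ofBijective (fun p => ⟨monomialGL p, (mem_MonomialGroup_iff _).2 ⟨p, rfl⟩⟩)
    ⟨fun _ _ h => monomialGL_injective (congrArg Subtype.val h), fun M =>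
      let ⟨p, hp⟩ := (mem_MonomialGroup_iff M.1).1 M.2
      ⟨p, Subtype.ext hp⟩⟩

/-- The action of a subgroup of `GL n F` on the Grassmannian. -/
@[reducible]
def grassmannianAction (G : Subgroup (GL (Fin n) F)) (k : ℕ) :
    MulAction G {V : Submodule F (Fin n → F) // finrank F V = k} where
  smul g V := ⟨V.1.map (Matrix.toLin' (g.1 : Matrix (Fin n) (Fin n) F)), by
    have h : Function.Injective (Matrix.toLin' (g.1 : Matrix (Fin n) (Fin n) F)) := by
      intro v w hvw
      have h2 := congrArg (Matrix.toLin' ((g.1⁻¹ : GL (Fin n) F) : Matrix (Fin n) (Fin n) F)) hvw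
      simpa [← Matrix.toLin'_mul_apply, ← Units.val_mul] using h2
    exact (Submodule.equivMapOfInjective _ h V.1).finrank_eq.symm.trans V.2⟩
  one_smul V := Subtype.ext (by
    change V.1.map (Matrix.toLin' (1 : Matrix (Fin n) (Fin n) F)) = V.1
    rw [Matrix.toLin'_one, Submodule.map_id])
  mul_smul g h V := Subtype.ext (by
    change V.1.map (Matrix.toLin' (g.1.1 * h.1.1)) =
      (V.1.map (Matrix.toLin' h.1.1)).map (Matrix.toLin' g.1.1)
    rw [Matrix.toLin'_mul, Submodule.map_comp])

variable [Fintype F]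

open scoped Classical in
/-- Burnside's lemma for the monomial group acting on the Grassmannian. -/
lemma numClassesDim_mul (k : ℕ) :
    numClassesDim F (MonomialGroup F n) k *
        (n.factorial * (Fintype.card F - 1) ^ n) =
      ∑ p : Equiv.Perm (Fin n) × (Fin n → Fˣ),
        ({W : Submodule F (Fin n → F) | finrank F W = k ∧ W.map (monomialMap p) = W} :
          Set _).ncard := by
  let _ := grassmannianAction (MonomialGroup F n) k
  have : Finite (GL (Fin n) F) := inferInstance
  let _ : Fintype (MonomialGroup F n) := Fintype.ofFinite _
  let _ : ∀ g : MonomialGroup F n, Fintype (MulAction.fixedBy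
    {V : Submodule F (Fin n → F) // finrank F V = k} g) := fun g => Fintype.ofFinite _
  let _ : Fintype (Quotient (MulAction.orbitRel (MonomialGroup F n)
    {V : Submodule F (Fin n → F) // finrank F V = k})) := Fintype.ofFinite _
  have h := MulAction.sum_card_fixedBy_eq_card_orbits_mul_card_group (MonomialGroup F n)
    {V : Submodule F (Fin n → F) // finrank F V = k}
  have hcard : Fintype.card (MonomialGroup F n) = n.factorial * (Fintype.card F - 1) ^ n := by
    rw [← Fintype.card_congr monomialEquiv, Fintype.card_prod, Fintype.card_perm, Fintype.card_fun,
      Fintype.card_units, Fintype.card_fin]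
  have horb : numClassesDim F (MonomialGroup F n) k =
      Fintype.card (Quotient (MulAction.orbitRel (MonomialGroup F n)
        {V : Submodule F (Fin n → F) // finrank F V = k})) := by
    rw [← Nat.card_eq_fintype_card]
    refine Nat.card_congr (Quot.congr (Equiv.refl _) fun V W => ?_)
    change _ ↔ MulAction.orbitRel (MonomialGroup F n) _ V W
    rw [MulAction.orbitRel_apply]
    constructor
    · rintro ⟨M, hM, hVW⟩
      exact MulAction.mem_orbit_symm.1 ⟨⟨M, hM⟩, Subtype.ext hVW⟩
    · intro hVW
      obtain ⟨M, hM⟩ := MulAction.mem_orbit_symm.1 hVW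
      exact ⟨M.1, M.2, congrArg Subtype.val hM⟩
  rw [horb, ← hcard, ← h, ← Equiv.sum_comp monomialEquiv]
  refine Finset.sum_congr rfl fun p _ => ?_
  rw [← Nat.card_eq_fintype_card]
  refine Nat.card_congr
    { toFun := fun W => ⟨W.1.1, W.1.2, ?_⟩
      invFun := fun W => ⟨⟨W.1, W.2.1⟩, ?_⟩
      left_inv := fun _ => rfl
      right_inv := fun _ => rfl }
  · have h1 : W.1.1.map (Matrix.toLin' (monomialGL p : Matrix (Fin n) (Fin n) F)) = W.1.1 :=
      congrArg Subtype.val W.2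
    rwa [toLin'_monomialGL] at h1
  · refine Subtype.ext ?_
    change W.1.map (Matrix.toLin' (monomialGL p : Matrix (Fin n) (Fin n) F)) = W.1
    rw [toLin'_monomialGL]
    exact W.2.2

end Burnside

section Asymptotics

open Module

variable {F : Type} [Field F] [Fintype F] {n : ℕ}

omit [Fintype F] in
lemma scalarDistance_le_card (p : Equiv.Perm (Fin n) × (Fin n → Fˣ)) : scalarDistance p ≤ n :=
  (scalarDistance_le p 0).trans ((Submodule.finrank_le _).trans_eq (by simp))

lemma ncard_fixed_of_scalarDistance_eq_zero (hn : 0 < n) (k : ℕ)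
    {p : Equiv.Perm (Fin n) × (Fin n → Fˣ)} (hp : scalarDistance p = 0) :
    ({W : Submodule F (Fin n → F) | finrank F W = k ∧ W.map (monomialMap p) = W} :
      Set _).ncard = Nat.card {W : Submodule F (Fin n → F) // finrank F W = k} := by
  obtain ⟨a, rfl⟩ := (scalarDistance_eq_zero_iff p hn).1 hp
  have h : (monomialMap (1, fun _ => a) : (Fin n → F) →ₗ[F] (Fin n → F)) =
      (a : F) • LinearMap.id := by
    refine LinearMap.ext fun v => funext fun i => ?_
    simp [monomialMap_apply]
  rw [← Nat.card_coe_set_eq]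
  congr 1
  have h1 : ∀ W : Submodule F (Fin n → F), W.map (monomialMap (1, fun _ => a)) = W := fun W => by
    rw [h, Submodule.map_smul _ _ _ a.ne_zero, Submodule.map_id]
  simp only [h1, and_true]
  rfl

lemma ncard_fixed_mul_le {k : ℕ} (hn : 100 ≤ n) (hk : 2 * n ≤ 5 * k) (hk' : 5 * k ≤ 3 * n)
    (p : Equiv.Perm (Fin n) × (Fin n → Fˣ)) :
    (({W : Submodule F (Fin n → F) | finrank F W = k ∧ W.map (monomialMap p) = W} :
      Set _).ncard : ℝ) * (Fintype.card F : ℝ) ^ (scalarDistance p * (n / 100)) ≤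
    (Fintype.card F * (n + 1) + 2) * ((Kq (Fintype.card F))⁻¹ ^ 2 *
        (Fintype.card F : ℝ) ^ (k * (n - k))) := by
  refine le_trans ?_ (ncard_invariant_mul_le (monomialMap p) (by simp) hn hk hk'
    (scalarDistance_le p) (exists_eq_scalarDistance p))
  gcongr
  · exact Set.toFinite _
  · intro h
    exact h.le

lemma sum_ncard_fixed_bounds {k : ℕ} (hn : 100 ≤ n) (hk : 2 * n ≤ 5 * k) (hk' : 5 * k ≤ 3 * n)
    (hx : ((n : ℝ) * (n * Fintype.card F)) ^ 2 * ((Fintype.card F : ℝ) ^ (n / 100))⁻¹ ≤ 1) :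
    (Fintype.card F - 1 : ℝ) * Nat.card {W : Submodule F (Fin n → F) // finrank F W = k} ≤
        numClassesDim F (MonomialGroup F n) k *
          (n.factorial * (Fintype.card F - 1 : ℝ) ^ n) ∧
      numClassesDim F (MonomialGroup F n) k *
          (n.factorial * (Fintype.card F - 1 : ℝ) ^ n) ≤
        (Fintype.card F - 1 : ℝ) * Nat.card {W : Submodule F (Fin n → F) // finrank F W = k} +
          n * (Fintype.card F * ((Fintype.card F * (n + 1) + 2) *
            ((Kq (Fintype.card F))⁻¹ ^ 2 * (Fintype.card F : ℝ) ^ (k * (n - k)))) *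
            (((n : ℝ) * (n * Fintype.card F)) ^ 2 * ((Fintype.card F : ℝ) ^ (n / 100))⁻¹)) := by
  classical
  have hn0 : 0 < n := by omega
  have hq : 1 < Fintype.card F := Fintype.one_lt_card
  have hq0 : (0 : ℝ) < Fintype.card F := by exact_mod_cast (by omega : 0 < Fintype.card F)
  set x : ℝ := ((n : ℝ) * (n * Fintype.card F)) ^ 2 * ((Fintype.card F : ℝ) ^ (n / 100))⁻¹ with hx'
  set C : ℝ := (Fintype.card F * (n + 1) + 2) *
    ((Kq (Fintype.card F))⁻¹ ^ 2 * (Fintype.card F : ℝ) ^ (k * (n - k))) with hC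
  have hC0 : 0 ≤ C := by positivity
  have hx0 : 0 ≤ x := by positivity
  let fixed : Equiv.Perm (Fin n) × (Fin n → Fˣ) → ℕ := fun p =>
    ({W : Submodule F (Fin n → F) | finrank F W = k ∧ W.map (monomialMap p) = W} : Set _).ncard
  have hburnside : (numClassesDim F (MonomialGroup F n) k *
      (n.factorial * (Fintype.card F - 1 : ℝ) ^ n) : ℝ) = ∑ p, (fixed p : ℝ) := by
    have h := congrArg (Nat.cast : ℕ → ℝ) (numClassesDim_mul (F := F) (n := n) k)
    push_cast [Nat.cast_sub hq.le] at h
    rw [h]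
  have hscalar : ∑ p with scalarDistance p = 0, (fixed p : ℝ) =
      (Fintype.card F - 1 : ℝ) * Nat.card {W : Submodule F (Fin n → F) // finrank F W = k} := by
    rw [Finset.sum_congr rfl fun p hp => by
      rw [show fixed p = _ from
        ncard_fixed_of_scalarDistance_eq_zero hn0 k (Finset.mem_filter.1 hp).2]]
    rw [Finset.sum_const, nsmul_eq_mul]
    congr 1
    have h := card_scalarDistance_eq_zero (F := F) hn0
    have h2 : ((Fintype.card F - 1 : ℕ) : ℝ) = (Fintype.card F : ℝ) - 1 := by
      rw [Nat.cast_sub hq.le, Nat.cast_one]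
    rw [← h2, ← h]
  have hother : ∑ p with scalarDistance p ≠ 0, (fixed p : ℝ) ≤
      n * (Fintype.card F * C * x) := by
    rw [← Finset.sum_fiberwise_of_maps_to (t := Finset.Icc 1 n)
      (g := fun p : Equiv.Perm (Fin n) × (Fin n → Fˣ) => scalarDistance p)
      (fun p hp => Finset.mem_Icc.2 ⟨Nat.one_le_iff_ne_zero.2 (Finset.mem_filter.1 hp).2,
        scalarDistance_le_card p⟩)]
    have hterm : ∀ r ∈ Finset.Icc 1 n,
        ∑ p ∈ Finset.univ.filter (fun p : Equiv.Perm (Fin n) × (Fin n → Fˣ) =>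
          scalarDistance p ≠ 0) with scalarDistance p = r, (fixed p : ℝ) ≤
        Fintype.card F * C * x := by
      intro r hr
      have hr1 : 1 ≤ r := (Finset.mem_Icc.1 hr).1
      have hfix : ∀ p : Equiv.Perm (Fin n) × (Fin n → Fˣ), scalarDistance p = r →
          (fixed p : ℝ) ≤ C * (((Fintype.card F : ℝ) ^ (n / 100))⁻¹) ^ r := by
        rintro p rfl
        have h := ncard_fixed_mul_le hn hk hk' p
        rw [inv_pow, ← pow_mul, mul_comm (n / 100), ← div_eq_mul_inv, le_div_iff₀ (by positivity)]
        exact h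
      have hcard : ((Finset.univ.filter fun p : Equiv.Perm (Fin n) × (Fin n → Fˣ) =>
          scalarDistance p = r).card : ℝ) ≤
          Fintype.card F * (n * (n * Fintype.card F)) ^ (2 * r) := by
        have h := card_scalarDistance_le (F := F) hn0 r
        have h' : (Finset.univ.filter fun p : Equiv.Perm (Fin n) × (Fin n → Fˣ) =>
          scalarDistance p = r).card ≤
          Fintype.card F * (n * (n * Fintype.card F)) ^ (2 * r) := by
          convert h
        exact_mod_cast h'
      calc ∑ p ∈ Finset.univ.filter (fun p : Equiv.Perm (Fin n) × (Fin n → Fˣ) =>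
            scalarDistance p ≠ 0) with scalarDistance p = r, (fixed p : ℝ)
          ≤ ∑ p with scalarDistance p = r, (fixed p : ℝ) := by
            refine Finset.sum_le_sum_of_subset_of_nonneg ?_ fun _ _ _ => Nat.cast_nonneg _
            exact Finset.filter_subset_filter _ (Finset.subset_univ _)
        _ ≤ ∑ p : Equiv.Perm (Fin n) × (Fin n → Fˣ) with scalarDistance p = r,
            C * (((Fintype.card F : ℝ) ^ (n / 100))⁻¹) ^ r :=
            Finset.sum_le_sum fun p hp => hfix p (Finset.mem_filter.1 hp).2
        _ ≤ (Fintype.card F * (n * (n * Fintype.card F)) ^ (2 * r)) *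
            (C * (((Fintype.card F : ℝ) ^ (n / 100))⁻¹) ^ r) := by
            rw [Finset.sum_const, nsmul_eq_mul]
            gcongr
        _ = Fintype.card F * C * x ^ r := by
            rw [hx', mul_pow, pow_mul]
            ring
        _ ≤ Fintype.card F * C * x := by
            gcongr
            exact pow_le_of_le_one hx0 hx (by omega)
    refine (Finset.sum_le_sum hterm).trans_eq ?_
    rw [Finset.sum_const, Nat.card_Icc, nsmul_eq_mul, Nat.add_sub_cancel]
  have hsplit := Finset.sum_filter_add_sum_filter_not Finset.univ
    (fun p : Equiv.Perm (Fin n) × (Fin n → Fˣ) => scalarDistance p = 0) fun p => (fixed p : ℝ)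
  rw [hburnside, ← hsplit, hscalar]
  constructor
  · exact le_add_of_nonneg_right (Finset.sum_nonneg fun _ _ => Nat.cast_nonneg _)
  · exact add_le_add_right hother _

lemma tendsto_pow_mul_inv_pow_div {q : ℕ} (hq : 2 ≤ q) (d m : ℕ) (hm : 0 < m) :
    Tendsto (fun n : ℕ => (n : ℝ) ^ d * ((q : ℝ) ^ (n / m))⁻¹) atTop (𝓝 0) := by
  have hq' : (2 : ℝ) ≤ q := by exact_mod_cast hq
  have h1 := tendsto_pow_const_mul_const_pow_of_abs_lt_one d (r := (q : ℝ)⁻¹) (by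
    rw [abs_of_pos (by positivity)]
    exact inv_lt_one_of_one_lt₀ (by linarith))
  have h2 : Tendsto (fun n : ℕ => n / m + 1) atTop atTop :=
    (tendsto_add_atTop_nat 1).comp (Nat.tendsto_div_const_atTop hm.ne')
  have h3 := (h1.comp h2).const_mul ((m : ℝ) ^ d * q)
  rw [mul_zero] at h3
  refine squeeze_zero (fun n => by positivity) (fun n => ?_) h3
  have h4 : (n : ℝ) ≤ m * ((n / m + 1 : ℕ) : ℝ) := by
    exact_mod_cast (Nat.lt_mul_div_succ n hm).le
  calc (n : ℝ) ^ d * ((q : ℝ) ^ (n / m))⁻¹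
      ≤ (m * ((n / m + 1 : ℕ) : ℝ)) ^ d * ((q : ℝ) ^ (n / m))⁻¹ := by gcongr
    _ = _ := by
      simp only [Function.comp_apply, mul_pow, inv_pow, pow_succ]
      field_simp

lemma StarCond.eventually_near_half {k : ℕ → ℕ} (h : StarCond 1 1 k) :
    ∀ᶠ n in atTop, 100 ≤ n ∧ 2 * n ≤ 5 * k n ∧ 5 * k n ≤ 3 * n := by
  filter_upwards [h.eventually_le_atBot 0, eventually_ge_atTop 100] with n hn hn'
  have h1 := Real.sqrt_nonneg n
  have h2 : (100 : ℝ) ≤ n := by exact_mod_cast hn'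
  have h3 : ((k n : ℝ) - n / 2) ^ 2 ≤ (n / 10) ^ 2 := by nlinarith
  have h4 := abs_le_of_sq_le_sq' h3 (by positivity)
  refine ⟨hn', ?_, ?_⟩
  · have : (2 * n : ℝ) ≤ 5 * k n := by linarith
    exact_mod_cast this
  · have : (5 * k n : ℝ) ≤ 3 * n := by linarith
    exact_mod_cast this

lemma tendsto_card_grassmannian_div {k : ℕ → ℕ} (hkn : ∀ n, k n ≤ n)
    (hk : Tendsto k atTop atTop) (hk' : Tendsto (fun n => n - k n) atTop atTop) :
    Tendsto (fun n => Kq (Fintype.card F) *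
      Nat.card {W : Submodule F (Fin n → F) // finrank F W = k n} /
        (Fintype.card F : ℝ) ^ (k n * (n - k n))) atTop (𝓝 1) := by
  have hq : 2 ≤ Fintype.card F := Fintype.one_lt_card
  have hK := (Kq_pos hq).ne'
  have hlim := (tendsto_KqTrunc hq).const_mul (Kq (Fintype.card F)) |>.div
    (((tendsto_KqTrunc hq).comp hk').mul ((tendsto_KqTrunc hq).comp hk)) (mul_ne_zero hK hK)
  rw [div_self (mul_ne_zero hK hK)] at hlim
  refine hlim.congr fun n => ?_
  have h := card_grassmannian (F := F) (V := Fin n → F) (k := k n) (by simpa using hkn n)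
  rw [Module.finrank_fin_fun] at h
  have h2 : (Fintype.card F : ℝ) ^ (k n * (n - k n)) ≠ 0 := by positivity
  simp only [Pi.div_apply, Function.comp_apply, h]
  field_simp

lemma numClassesDim_div_bounds {k : ℕ} (hn : 100 ≤ n) (hk : 2 * n ≤ 5 * k) (hk' : 5 * k ≤ 3 * n)
    (hx : ((n : ℝ) * (n * Fintype.card F)) ^ 2 * ((Fintype.card F : ℝ) ^ (n / 100))⁻¹ ≤ 1) :
    Kq (Fintype.card F) * Nat.card {W : Submodule F (Fin n → F) // finrank F W = k} /
        (Fintype.card F : ℝ) ^ (k * (n - k)) ≤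
      numClassesDim F (MonomialGroup F n) k / ((Fintype.card F : ℝ) ^ (k * (n - k)) /
        (Kq (Fintype.card F) * n.factorial * (Fintype.card F - 1 : ℝ) ^ (n - 1))) ∧
    numClassesDim F (MonomialGroup F n) k / ((Fintype.card F : ℝ) ^ (k * (n - k)) /
        (Kq (Fintype.card F) * n.factorial * (Fintype.card F - 1 : ℝ) ^ (n - 1))) ≤
      Kq (Fintype.card F) * Nat.card {W : Submodule F (Fin n → F) // finrank F W = k} /
        (Fintype.card F : ℝ) ^ (k * (n - k)) +
      4 * (Fintype.card F : ℝ) ^ 4 / (Kq (Fintype.card F) * (Fintype.card F - 1 : ℝ)) *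
        ((n : ℝ) ^ 6 * ((Fintype.card F : ℝ) ^ (n / 100))⁻¹) := by
  obtain ⟨hlower, hupper⟩ := sum_ncard_fixed_bounds hn hk hk' hx
  have hq : 2 ≤ Fintype.card F := Fintype.one_lt_card
  have hq2 : (2 : ℝ) ≤ Fintype.card F := by exact_mod_cast hq
  have hK := Kq_pos hq
  have hn1 : (100 : ℝ) ≤ n := by exact_mod_cast hn
  have hpow : (Fintype.card F - 1 : ℝ) ^ n =
      (Fintype.card F - 1 : ℝ) * (Fintype.card F - 1 : ℝ) ^ (n - 1) :=
    (mul_pow_sub_one (by omega) _).symm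
  rw [hpow] at hlower hupper
  generalize (Fintype.card F - 1 : ℝ) ^ (n - 1) = s at *
  generalize (Nat.card {W : Submodule F (Fin n → F) // finrank F W = k} : ℝ) = G at *
  generalize (numClassesDim F (MonomialGroup F n) k : ℝ) = N at *
  generalize (n.factorial : ℝ) = f at *
  have hQ : 0 < (Fintype.card F : ℝ) ^ (k * (n - k)) := by positivity
  have hy : 0 < ((Fintype.card F : ℝ) ^ (n / 100))⁻¹ := by positivity
  generalize (Fintype.card F : ℝ) ^ (k * (n - k)) = Q at *
  generalize ((Fintype.card F : ℝ) ^ (n / 100))⁻¹ = y at *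
  generalize Kq (Fintype.card F) = K at *
  generalize (Fintype.card F : ℝ) = q at *
  have hq1 : 0 < q - 1 := by linarith
  have hratio : N / (Q / (K * f * s)) = K / ((q - 1) * Q) * (N * (f * ((q - 1) * s))) := by
    rw [div_div_eq_mul_div]
    field_simp
  rw [hratio]
  constructor
  · calc K * G / Q = K / ((q - 1) * Q) * ((q - 1) * G) := by field_simp
      _ ≤ _ := by gcongr
  · have hlin : q * (n + 1) + 2 ≤ 4 * q * n := by nlinarith
    calc K / ((q - 1) * Q) * (N * (f * ((q - 1) * s)))
        ≤ K / ((q - 1) * Q) * ((q - 1) * G +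
          n * (q * ((q * (n + 1) + 2) * (K⁻¹ ^ 2 * Q)) * ((n * (n * q)) ^ 2 * y))) := by gcongr
      _ ≤ K / ((q - 1) * Q) * ((q - 1) * G +
          n * (q * ((4 * q * n) * (K⁻¹ ^ 2 * Q)) * ((n * (n * q)) ^ 2 * y))) := by gcongr
      _ = _ := by field_simp

end Asymptotics

theorem stmt10 (q : ℕ) (F : Type) [Field F] [Fintype F] (hq : Fintype.card F = q) :
    ∃ A > (0 : ℝ), ∃ ε > (0 : ℝ), ∀ k : ℕ → ℕ, (∀ n, k n ≤ n) → StarCond A ε k →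
      Tendsto (fun n : ℕ => (numClassesDim F (MonomialGroup F n) (k n) : ℝ) /
          ((q : ℝ) ^ (k n * (n - k n)) /
            (Kq q * (n.factorial : ℝ) * ((q : ℝ) - 1) ^ (n - 1))))
        atTop (𝓝 1) := by
  refine ⟨1, one_pos, 1, one_pos, fun k hkn hstar => ?_⟩
  subst hq
  have hq : 2 ≤ Fintype.card F := Fintype.one_lt_card
  have hhalf := hstar.eventually_near_half
  have hdiv : Tendsto (fun n : ℕ => n / 5) atTop atTop :=
    Nat.tendsto_div_const_atTop (by norm_num)
  have hk : Tendsto k atTop atTop :=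
    tendsto_atTop_mono' atTop (hhalf.mono fun n hn => by omega) hdiv
  have hk' : Tendsto (fun n => n - k n) atTop atTop :=
    tendsto_atTop_mono' atTop (hhalf.mono fun n hn => by change n / 5 ≤ n - k n; omega) hdiv
  have hmain := tendsto_card_grassmannian_div (F := F) hkn hk hk'
  have herror := (tendsto_pow_mul_inv_pow_div hq 6 100 (by norm_num)).const_mul
    (4 * (Fintype.card F : ℝ) ^ 4 / (Kq (Fintype.card F) * (Fintype.card F - 1 : ℝ)))
  rw [mul_zero] at herror
  have hupper := hmain.add herror
  rw [add_zero] at hupper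
  have hsmall : ∀ᶠ n : ℕ in atTop,
      ((n : ℝ) * (n * Fintype.card F)) ^ 2 * ((Fintype.card F : ℝ) ^ (n / 100))⁻¹ ≤ 1 := by
    have h := (tendsto_pow_mul_inv_pow_div hq 4 100 (by norm_num)).const_mul
      ((Fintype.card F : ℝ) ^ 2)
    rw [mul_zero] at h
    filter_upwards [h.eventually_le_const one_pos] with n hn
    calc _ = _ := by ring
      _ ≤ 1 := hn
  refine tendsto_of_tendsto_of_tendsto_of_le_of_le' hmain hupper ?_ ?_
  · filter_upwards [hhalf, hsmall] with n hn hx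
    exact (numClassesDim_div_bounds hn.1 hn.2.1 hn.2.2 hx).1
  · filter_upwards [hhalf, hsmall] with n hn hx
    exact (numClassesDim_div_bounds hn.1 hn.2.1 hn.2.2 hx).2
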